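/- Let K be a scattered compact Hausdorff space and let X be a subprojective real Banach space. Then the Banach space C(K,X) of continuous X-valued functions on K with the supremum norm is subprojective. -/

import Mathlib

/-- A real normed space `X` is *subprojective* if every closed infinite-dimensional
subspace of `X` contains an infinite-dimensional closed subspace that is
complemented in `X` (i.e. is the range of a continuous linear projection on `X`). -/
def Subprojective (X : Type*) [NormedAddCommGroup X] [NormedSpace ℝ X] : Prop :=
  ∀ M : Submodule ℝ X, IsClosed (M : Set X) → ¬ FiniteDimensional ℝ M →
    ∃ N : Submodule ℝ X, N ≤ M ∧ IsClosed (N : Set X) ∧ ¬ FiniteDimensional ℝ N ∧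
      N.ClosedComplemented

/-- A topological space is *scattered* if every nonempty closed subset has a point
isolated in that subset. -/
def IsScattered (K : Type*) [TopologicalSpace K] : Prop :=
  ∀ S : Set K, S.Nonempty → IsClosed S → ∃ x ∈ S, ∃ U : Set K, IsOpen U ∧ U ∩ S = {x}

section SubprojAux

variable {K : Type*} [TopologicalSpace K] [CompactSpace K]
  {X : Type*} [NormedAddCommGroup X] [NormedSpace ℝ X]

/-- Restriction to `S` is strictly singular on `M`. -/
def SmallOn (M : Submodule ℝ C(K, X)) (S : Set K) : Prop :=
  ∀ N ≤ M, ¬ N.FG → ∀ ε > (0:ℝ), ∃ N' ≤ N, ¬ N'.FG ∧ ∀ f ∈ N', ∀ s ∈ S, ‖f s‖ ≤ ε * ‖f‖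

lemma inf_ker_not_fg {E : Type*} [NormedAddCommGroup E] [NormedSpace ℝ E]
    (N : Submodule ℝ E) (hN : ¬ N.FG) (s : Finset (E →L[ℝ] ℝ)) :
    ∃ N' ≤ N, ¬ N'.FG ∧ ∀ φ ∈ s, ∀ x ∈ N', φ x = 0 := by
  classical
  induction s using Finset.induction_on with
  | empty => exact ⟨N, le_rfl, hN, by simp⟩
  | insert φ s _ ih =>
    obtain ⟨N', h1, h2, h3⟩ := ih
    refine ⟨N' ⊓ LinearMap.ker (φ : E →ₗ[ℝ] ℝ), inf_le_left.trans h1, ?_, ?_⟩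
    · intro h
      apply h2
      refine Submodule.fg_of_fg_map_of_fg_inf_ker (φ : E →ₗ[ℝ] ℝ) ?_ h
      exact IsNoetherian.noetherian _
    · intro ψ hψ x hx
      rcases Finset.mem_insert.1 hψ with rfl | hψ
      · exact hx.2
      · exact h3 ψ hψ x hx.1

lemma coef_bound {E : Type*} [NormedAddCommGroup E] [NormedSpace ℝ E]
    (x : ℕ → E) (φ : ℕ → E →L[ℝ] ℝ) (hx : ∀ n, ‖x n‖ = 1) (hφ : ∀ n, ‖φ n‖ ≤ 1)
    (h1 : ∀ n, φ n (x n) = 1) (h0 : ∀ m n, m < n → φ m (x n) = 0) (a : ℕ →₀ ℝ) (n : ℕ) :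
    |a n| ≤ 2 ^ n * ‖a.sum fun i c => c • x i‖ := by
  set y := a.sum fun i c => c • x i with hy
  induction n using Nat.strong_induction_on with
  | _ n ih =>
    obtain ⟨m, hm1, hm2⟩ : ∃ m, n < m ∧ a.support ⊆ Finset.range m := by
      obtain ⟨m, hm⟩ := a.support.exists_nat_subset_range
      exact ⟨max m (n+1), by omega, hm.trans (Finset.range_mono (le_max_left _ _))⟩
    have hy' : y = ∑ i ∈ Finset.range m, a i • x i := by
      rw [hy]; exact Finsupp.sum_of_support_subset _ hm2 _ (by simp)
    have e1 : φ n y = ∑ i ∈ Finset.range n, a i * φ n (x i) + a n := by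
      rw [hy', map_sum]
      have : m = (n + 1) + (m - (n+1)) := by omega
      rw [this, Finset.sum_range_add, Finset.sum_range_succ]
      have : ∑ i ∈ Finset.range (m - (n+1)), φ n (a (n+1+i) • x (n+1+i)) = 0 := by
        refine Finset.sum_eq_zero fun i _ => ?_
        simp [h0 n (n+1+i) (by omega)]
      rw [this]
      simp [h1]
    have e2 : |a n| ≤ ‖y‖ + ∑ i ∈ Finset.range n, |a i| := by
      have : a n = φ n y - ∑ i ∈ Finset.range n, a i * φ n (x i) := by rw [e1]; ring
      rw [this]
      refine (abs_sub _ _).trans (add_le_add ?_ ?_)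
      · have := (φ n).le_of_opNorm_le (hφ n) y
        simpa using this
      · refine (Finset.abs_sum_le_sum_abs _ _).trans (Finset.sum_le_sum fun i _ => ?_)
        rw [abs_mul]
        have := (φ n).le_of_opNorm_le (hφ n) (x i)
        rw [hx, Real.norm_eq_abs] at this
        nlinarith [abs_nonneg (a i)]
    have e3 : ∑ i ∈ Finset.range n, |a i| ≤ ∑ i ∈ Finset.range n, 2 ^ i * ‖y‖ :=
      Finset.sum_le_sum fun i hi => ih i (Finset.mem_range.1 hi)
    rw [← Finset.sum_mul, geom_sum_eq (by norm_num)] at e3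
    norm_num at e3
    linarith

lemma lemmaA (N : Submodule ℝ C(K, X)) (hN : ¬ N.FG) (S : Set K)
    (h : ∀ N' ≤ N, ¬ N'.FG → ∀ c > (0:ℝ), ∃ f ∈ N', f ≠ 0 ∧ ∀ s ∈ S, ‖f s‖ ≤ c * ‖f‖)
    (ε : ℝ) (hε : 0 < ε) :
    ∃ N' ≤ N, ¬ N'.FG ∧ ∀ f ∈ N', ∀ s ∈ S, ‖f s‖ ≤ ε * ‖f‖ := by
  classical
  obtain ⟨F, hF1, hF2⟩ := exists_seq_of_forall_finset_exists
    (fun p : C(K, X) × (C(K, X) →L[ℝ] ℝ) × ℝ => p.1 ∈ N ∧ ‖p.1‖ = 1 ∧ ‖p.2.1‖ ≤ 1 ∧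
      p.2.1 p.1 = 1 ∧ 0 < p.2.2 ∧ p.2.2 ≤ ε / 2 ∧ ∀ s ∈ S, ‖p.1 s‖ ≤ p.2.2)
    (fun p q => p.2.1 q.1 = 0 ∧ q.2.2 ≤ p.2.2 / 4) (by
      intro s hs
      obtain ⟨N', h1, h2, h3⟩ := inf_ker_not_fg N hN (s.image fun p => p.2.1)
      obtain ⟨η, hη0, hη1, hη2⟩ : ∃ η > 0, η ≤ ε / 2 ∧ ∀ p ∈ s, η ≤ p.2.2 / 4 := by
        have : ∀ᶠ η in nhdsWithin (0:ℝ) (Set.Ioi 0), η ≤ ε / 2 ∧ ∀ p ∈ s, η ≤ p.2.2 / 4 := by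
          refine Filter.Eventually.and ?_ ?_
          · exact (eventually_le_nhds (by positivity)).filter_mono nhdsWithin_le_nhds
          · rw [Filter.eventually_all_finset]
            intro p hp
            have := (hs p hp).2.2.2.2.1
            exact (eventually_le_nhds (by positivity)).filter_mono nhdsWithin_le_nhds
        obtain ⟨η, h, h'⟩ := (this.and self_mem_nhdsWithin).exists
        exact ⟨η, h', h⟩
      obtain ⟨f, hf, hf0, hfS⟩ := h N' h1 h2 η hη0
      have hfn : 0 < ‖f‖ := norm_pos_iff.2 hf0
      have hg1 : ‖‖f‖⁻¹ • f‖ = 1 := by rw [norm_smul, norm_inv, norm_norm]; field_simp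
      obtain ⟨g, hg, hg'⟩ := exists_dual_vector ℝ (‖f‖⁻¹ • f) (by
        intro h0; rw [h0] at hg1; simp at hg1)
      refine ⟨⟨‖f‖⁻¹ • f, g, η⟩, ⟨N.smul_mem _ (h1 hf), hg1, hg.le, ?_, hη0, hη1, ?_⟩, ?_⟩
      · rw [hg', hg1]; simp
      · intro s hs
        simp only [ContinuousMap.coe_smul, Pi.smul_apply, norm_smul, norm_inv, norm_norm]
        rw [inv_mul_le_iff₀ hfn, mul_comm]
        exact hfS s hs
      · intro p hp
        exact ⟨h3 _ (Finset.mem_image_of_mem _ hp) _ (N'.smul_mem _ hf), hη2 p hp⟩)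
  have hcb := coef_bound (fun n => (F n).1) (fun n => (F n).2.1) (fun n => (hF1 n).2.1)
    (fun n => (hF1 n).2.2.1) (fun n => (hF1 n).2.2.2.1) (fun m n hmn => (hF2 m n hmn).1)
  have hη : ∀ n, (F n).2.2 ≤ ε / 2 * (1/4) ^ n := by
    intro n
    induction n with
    | zero => simpa using (hF1 0).2.2.2.2.2.1
    | succ n ih =>
      have := (hF2 n (n+1) (by omega)).2
      rw [pow_succ]; linarith
  refine ⟨Submodule.span ℝ (Set.range fun n => (F n).1), ?_, ?_, ?_⟩
  · rw [Submodule.span_le]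
    rintro _ ⟨n, rfl⟩
    exact (hF1 n).1
  · intro hfg
    have hli : LinearIndependent ℝ (fun n => (F n).1) := by
      rw [linearIndependent_iff]
      intro a ha
      ext n
      have := hcb a n
      rw [Finsupp.linearCombination_apply] at ha
      rw [ha] at this
      simpa using this
    have hli2 := linearIndependent_span hli
    have : Module.Finite ℝ (Submodule.span ℝ (Set.range fun n => (F n).1)) :=
      Module.Finite.iff_fg.2 hfg
    have := hli2.finite
    exact not_finite ℕ
  · intro f hf s hs
    obtain ⟨a, rfl⟩ := Finsupp.mem_span_range_iff_exists_finsupp.1 hf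
    set y := a.sum fun i c => c • (F i).1 with hy
    have hcb := hcb a
    change ∀ n, |a n| ≤ 2 ^ n * ‖y‖ at hcb
    obtain ⟨m, hm⟩ := a.support.exists_nat_subset_range
    have hy' : y = ∑ i ∈ Finset.range m, a i • (F i).1 := by
      rw [hy]; exact Finsupp.sum_of_support_subset _ hm _ (by simp)
    have : ‖y s‖ ≤ ∑ i ∈ Finset.range m, (1/2)^i * (ε / 2 * ‖y‖) := by
      conv_lhs => rw [hy']
      rw [ContinuousMap.sum_apply]
      refine (norm_sum_le _ _).trans (Finset.sum_le_sum fun i _ => ?_)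
      rw [ContinuousMap.smul_apply, norm_smul, Real.norm_eq_abs]
      have h1 := (hF1 i).2.2.2.2.2.2 s hs
      calc |a i| * ‖(F i).1 s‖ ≤ (2 ^ i * ‖y‖) * (ε / 2 * (1/4) ^ i) :=
            mul_le_mul (hcb i) (h1.trans (hη i)) (norm_nonneg _) (by positivity)
        _ = (2 * (1/4)) ^ i * (ε / 2 * ‖y‖) := by rw [mul_pow]; ring
        _ = _ := by norm_num
    refine this.trans ?_
    rw [← Finset.sum_mul, geom_sum_eq (by norm_num)]
    have : (0:ℝ) < (1/2)^m := by positivity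
    have h3 : (((1:ℝ)/2)^m - 1)/(1/2 - 1) ≤ 2 := by
      rw [div_le_iff_of_neg (by norm_num)]; linarith
    calc _ ≤ 2 * (ε / 2 * ‖y‖) := by gcongr
      _ = ε * ‖y‖ := by ring

lemma not_smallOn {M : Submodule ℝ C(K, X)} {S : Set K} (h : ¬ SmallOn M S) :
    ∃ N ≤ M, ¬ N.FG ∧ ∃ c > (0:ℝ), ∀ f ∈ N, f ≠ 0 → ∃ s ∈ S, c * ‖f‖ < ‖f s‖ := by
  contrapose! h
  intro N hN hfg ε hε
  exact lemmaA N hfg S (fun N' h1 h2 c hc => h N' (h1.trans hN) h2 c hc) ε hε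

lemma SmallOn.mono {M : Submodule ℝ C(K, X)} {S T : Set K} (h : SmallOn M T) (hST : S ⊆ T) :
    SmallOn M S := by
  intro N hN hfg ε hε
  obtain ⟨N', h1, h2, h3⟩ := h N hN hfg ε hε
  exact ⟨N', h1, h2, fun f hf s hs => h3 f hf s (hST hs)⟩

lemma SmallOn.union {M : Submodule ℝ C(K, X)} {S T : Set K} (hS : SmallOn M S)
    (hT : SmallOn M T) : SmallOn M (S ∪ T) := by
  intro N hN hfg ε hε
  obtain ⟨N', h1, h2, h3⟩ := hS N hN hfg ε hε
  obtain ⟨N'', h4, h5, h6⟩ := hT N' (h1.trans hN) h2 ε hε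
  refine ⟨N'', h4.trans h1, h5, fun f hf s hs => ?_⟩
  rcases hs with hs | hs
  · exact h3 f (h4 hf) s hs
  · exact h6 f hf s hs

lemma smallOn_empty (M : Submodule ℝ C(K, X)) : SmallOn M ∅ := by
  intro N hN hfg ε hε
  exact ⟨N, le_rfl, hfg, by simp⟩

lemma smallOn_of_compact {M : Submodule ℝ C(K, X)} {S : Set K} (hS : IsCompact S)
    (h : ∀ s ∈ S, ∃ T ∈ nhds s, SmallOn M T) : SmallOn M S := by
  refine hS.induction_on (smallOn_empty M) (fun _ _ hst ht => ht.mono hst)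
    (fun _ _ h1 h2 => h1.union h2) fun s hs => ?_
  obtain ⟨T, h1, h2⟩ := h s hs
  exact ⟨T, mem_nhdsWithin_of_mem_nhds h1, h2⟩

lemma ne_zero_of_not_fg {E : Type*} [NormedAddCommGroup E] [NormedSpace ℝ E]
    {N : Submodule ℝ E} (h : ¬ N.FG) : ∃ f ∈ N, f ≠ 0 := by
  contrapose! h
  rw [(Submodule.eq_bot_iff N).2 h]
  exact Submodule.fg_bot

lemma not_smallOn_univ {M : Submodule ℝ C(K, X)} (hM : ¬ M.FG) : ¬ SmallOn M Set.univ := by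
  intro h
  obtain ⟨N, -, h2, h3⟩ := h M le_rfl hM (1/2) (by norm_num)
  obtain ⟨f, hf, hf0⟩ := ne_zero_of_not_fg h2
  have : ‖f‖ ≤ 1/2 * ‖f‖ := by
    rw [ContinuousMap.norm_le _ (by positivity)]
    exact fun s => h3 f hf s trivial
  have := norm_pos_iff.2 hf0
  linarith

lemma exists_subseq_tendsto [T2Space K] (hK : IsScattered K) (t : ℕ → K) :
    ∃ s, ∃ φ : ℕ → ℕ, StrictMono φ ∧ Filter.Tendsto (t ∘ φ) Filter.atTop (nhds s) := by
  obtain ⟨s, hs, U, hU, hUs⟩ := hK {x | MapClusterPt x Filter.atTop t} (by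
      obtain ⟨x, hx⟩ := exists_clusterPt_of_compactSpace (Filter.map t Filter.atTop)
      exact ⟨x, hx⟩) isClosed_setOfPred_clusterPt
  have hsU : s ∈ U := by
    have : s ∈ U ∩ {x | MapClusterPt x Filter.atTop t} := by rw [hUs]; rfl
    exact this.1
  obtain ⟨V, hV, hVc, hVU⟩ := exists_mem_nhds_isClosed_subset (hU.mem_nhds hsU)
  have hfr : ∃ᶠ n in Filter.atTop, t n ∈ V := (mapClusterPt_iff_frequently.1 hs) V hV
  obtain ⟨φ, hφ, hφV⟩ := Filter.extraction_of_frequently_atTop hfr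
  refine ⟨s, φ, hφ, ?_⟩
  refine le_nhds_of_unique_clusterPt fun y hy => ?_
  have h1 : MapClusterPt y Filter.atTop t := by
    have : Filter.map (t ∘ φ) Filter.atTop ≤ Filter.map t Filter.atTop := by
      rw [← Filter.map_map]
      exact Filter.map_mono hφ.tendsto_atTop
    exact ClusterPt.mono hy this
  have h2 : y ∈ V := by
    by_contra hyV
    have h3 : ∃ᶠ n in Filter.atTop, (t ∘ φ) n ∈ Vᶜ :=
      (mapClusterPt_iff_frequently.1 (show MapClusterPt y Filter.atTop (t ∘ φ) from hy)) Vᶜ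
        (hVc.isOpen_compl.mem_nhds hyV)
    obtain ⟨n, hn⟩ := h3.exists
    exact hn (hφV n)
  have : y ∈ U ∩ {x | MapClusterPt x Filter.atTop t} := ⟨hVU h2, h1⟩
  rw [hUs] at this
  exact this

end SubprojAux

section SubprojAux2

lemma range_complemented {Z E : Type*} [NormedAddCommGroup Z] [NormedSpace ℝ Z]
    [NormedAddCommGroup E] [NormedSpace ℝ E] (T : Z →L[ℝ] E) (Φ : E →L[ℝ] Z) (Ψ : Z →L[ℝ] Z)
    (h : ∀ z, Ψ (Φ (T z)) = z) (hZ : ¬ FiniteDimensional ℝ Z) :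
    IsClosed (LinearMap.range (T : Z →ₗ[ℝ] E) : Set E) ∧
      ¬ FiniteDimensional ℝ (LinearMap.range (T : Z →ₗ[ℝ] E)) ∧
      (LinearMap.range (T : Z →ₗ[ℝ] E)).ClosedComplemented := by
  have hc : (LinearMap.range (T : Z →ₗ[ℝ] E)).ClosedComplemented := by
    refine ⟨(T.comp (Ψ.comp Φ)).codRestrict _ (fun x => ⟨Ψ (Φ x), rfl⟩), ?_⟩
    rintro ⟨_, z, rfl⟩
    exact Subtype.ext (congrArg T (h z))
  refine ⟨hc.isClosed, ?_, hc⟩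
  intro hfd
  apply hZ
  have hinj : Function.Injective (T : Z →ₗ[ℝ] E) := by
    intro x y hxy
    have hxy : T x = T y := hxy
    rw [← h x, ← h y, hxy]
  exact FiniteDimensional.of_injective ((T : Z →ₗ[ℝ] E).rangeRestrict)
    ((LinearMap.injective_rangeRestrict_iff _).2 hinj)

lemma case_one {E X : Type*} [NormedAddCommGroup E] [NormedSpace ℝ E] [CompleteSpace E]
    [NormedAddCommGroup X] [NormedSpace ℝ X] [CompleteSpace X] (hX : Subprojective X)
    (L : E →L[ℝ] X) (M N : Submodule ℝ E) (hM : IsClosed (M : Set E)) (hNM : N ≤ M)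
    (hN : ¬ N.FG) (c : ℝ) (hc : 0 < c) (h : ∀ f ∈ N, c * ‖f‖ ≤ ‖L f‖) :
    ∃ N : Submodule ℝ E, N ≤ M ∧ IsClosed (N : Set E) ∧ ¬ FiniteDimensional ℝ N ∧
      N.ClosedComplemented := by
  set N1 := N.topologicalClosure with hN1
  have hN1M : N1 ≤ M := Submodule.topologicalClosure_minimal _ hNM hM
  have hN1c : IsClosed (N1 : Set E) := Submodule.isClosed_topologicalClosure _
  have : CompleteSpace N1 := hN1c.completeSpace_coe
  have h1 : ∀ f ∈ N1, c * ‖f‖ ≤ ‖L f‖ := by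
    intro f hf
    have hcl : IsClosed {f : E | c * ‖f‖ ≤ ‖L f‖} := isClosed_le (by fun_prop) (by fun_prop)
    exact closure_minimal (show (N : Set E) ⊆ _ from h) hcl hf
  set L1 : N1 →L[ℝ] X := L.comp N1.subtypeL with hL1
  have hanti : AntilipschitzWith (Real.toNNReal c⁻¹) L1 := by
    refine ContinuousLinearMap.antilipschitz_of_bound _ fun x => ?_
    rw [Real.coe_toNNReal _ (by positivity), inv_mul_eq_div, le_div_iff₀ hc, mul_comm]
    exact h1 x x.2
  have hclo : IsClosed (Set.range L1) := hanti.isClosed_range L1.uniformContinuous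
  set e := L1.equivRange hanti.injective hclo with he
  have hN1f : ¬ FiniteDimensional ℝ N1 := by
    intro hfd
    apply hN
    rw [← Module.Finite.iff_fg]
    exact FiniteDimensional.of_injective (Submodule.inclusion N.le_topologicalClosure)
      (Submodule.inclusion_injective _)
  obtain ⟨N0, hN0, -, hN0f, P, hP⟩ := hX L1.range hclo (by
    intro hfd
    apply hN1f
    exact FiniteDimensional.of_injective (e.toLinearEquiv : N1 →ₗ[ℝ] L1.range)
      e.injective)
  set T : N0 →L[ℝ] E := N1.subtypeL.comp ((e.symm : L1.range →L[ℝ] N1).comp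
    (N0.subtypeL.codRestrict L1.range fun x => hN0 x.2)) with hT
  have hLT : ∀ z, L (T z) = z := by
    intro z
    have : L1 (e.symm ⟨z, hN0 z.2⟩) = z := by
      have := congrArg Subtype.val (e.apply_symm_apply ⟨z, hN0 z.2⟩)
      exact this
    exact this
  obtain ⟨a, b, c⟩ := range_complemented T (P.comp L) (ContinuousLinearMap.id ℝ _)
    (by intro z; simp [hLT, hP]) hN0f
  refine ⟨_, ?_, a, b, c⟩
  rintro _ ⟨z, rfl⟩
  exact hN1M (e.symm ⟨z, hN0 z.2⟩).2

open scoped ZeroAtInfty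

lemma c0_infinite : ¬ FiniteDimensional ℝ C₀(ℕ, ℝ) := by
  intro hfd
  let v : ℕ → C₀(ℕ, ℝ) := fun n =>
    { toFun := Pi.single n 1
      continuous_toFun := continuous_of_discreteTopology
      zero_at_infty' := by
        rw [Filter.cocompact_eq_cofinite]
        refine tendsto_const_nhds.congr' ?_
        filter_upwards [(Set.finite_singleton n).compl_mem_cofinite] with m hm
        have : m ≠ n := hm
        simp [this] }
  have hli : LinearIndependent ℝ v := by
    rw [linearIndependent_iff']
    intro s g hg i hi
    have := congrArg (fun f : C₀(ℕ, ℝ) => f i) hg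
    simp only [ZeroAtInftyContinuousMap.coe_zero, Pi.zero_apply] at this
    have h2 : ∀ s : Finset ℕ, (∑ j ∈ s, g j • v j) i = ∑ j ∈ s, g j * v j i := by
      intro s
      induction s using Finset.induction_on with
      | empty => simp
      | insert a s ha ih => rw [Finset.sum_insert ha, Finset.sum_insert ha, ← ih]; rfl
    rw [h2, Finset.sum_eq_single i] at this
    · have h3 : v i i = 1 := by change (Pi.single i 1 : ℕ → ℝ) i = 1; simp
      simpa [h3] using this
    · intro j _ hj
      have h3 : v j i = 0 := by
        change (Pi.single j 1 : ℕ → ℝ) i = 0; simp [hj.symm]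
      simp [h3]
    · intro h; exact absurd hi h
  have := hli.finite
  exact not_finite ℕ

lemma c0_norm_le (a : C₀(ℕ, ℝ)) {C : ℝ} (hC : 0 ≤ C) (h : ∀ n, |a n| ≤ C) : ‖a‖ ≤ C := by
  rw [← ZeroAtInftyContinuousMap.norm_toBCF_eq_norm]
  exact (BoundedContinuousFunction.norm_le hC).2 h

lemma c0_le_norm (a : C₀(ℕ, ℝ)) (n : ℕ) : |a n| ≤ ‖a‖ := by
  rw [← ZeroAtInftyContinuousMap.norm_toBCF_eq_norm]
  exact a.toBCF.norm_coe_le_norm n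

lemma case_two {E : Type*} [NormedAddCommGroup E] [NormedSpace ℝ E] [CompleteSpace E]
    (M : Submodule ℝ E) (hM : IsClosed (M : Set E)) (f : ℕ → E) (hfM : ∀ n, f n ∈ M)
    (C : ℝ) (hC : 0 ≤ C)
    (hf : ∀ (s : Finset ℕ) (a : ℕ → ℝ) (b : ℝ), 0 ≤ b → (∀ i ∈ s, |a i| ≤ b) →
      ‖∑ i ∈ s, a i • f i‖ ≤ C * b)
    (φ : ℕ → E →L[ℝ] ℝ) (B : ℝ) (hB : 0 ≤ B) (hφB : ∀ n x, |φ n x| ≤ B * ‖x‖)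
    (hφ0 : ∀ x, Filter.Tendsto (fun n => φ n x) Filter.atTop (nhds 0))
    (η : ℕ → ℝ) (r : ℝ) (hη : HasSum η r) (hr : r < 1)
    (hφf : ∀ k j, |φ k (f j) - if j = k then 1 else 0| ≤ η j) :
    ∃ N : Submodule ℝ E, N ≤ M ∧ IsClosed (N : Set E) ∧ ¬ FiniteDimensional ℝ N ∧
      N.ClosedComplemented := by
  classical
  have hsum : ∀ a : C₀(ℕ, ℝ), Summable fun i => a i • f i := by
    intro a
    rw [summable_iff_vanishing_norm]
    intro ε hε
    have ha := zero_at_infty a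
    rw [Filter.cocompact_eq_cofinite] at ha
    obtain ⟨b, hb, hCb⟩ : ∃ b > 0, C * b < ε := by
      refine ⟨ε / (C + 1), by positivity, ?_⟩
      rw [mul_div_assoc', div_lt_iff₀ (by positivity)]; nlinarith
    have h1 : ∀ᶠ i in Filter.cofinite, |a i| < b := by
      have := ha.abs
      rw [abs_zero] at this
      exact this.eventually (eventually_lt_nhds hb)
    refine ⟨(Filter.eventually_cofinite.1 h1).toFinset, fun t ht => ?_⟩
    refine (hf t a b hb.le fun i hi => ?_).trans_lt hCb
    have := Finset.disjoint_left.1 ht hi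
    simp only [Set.Finite.mem_toFinset, Set.mem_ofPred_eq, not_not] at this
    exact this.le
  let T : C₀(ℕ, ℝ) →L[ℝ] E := LinearMap.mkContinuous
    { toFun := fun a => ∑' i, a i • f i
      map_add' := by
        intro a b
        rw [← (hsum a).tsum_add (hsum b)]
        simp [add_smul]
      map_smul' := by
        intro c a
        simp only [RingHom.id_apply]
        rw [← (hsum a).tsum_const_smul c]
        simp [mul_smul] } C (by
      intro a
      refine le_of_tendsto (hsum a).hasSum.norm (Filter.Eventually.of_forall fun s => ?_)
      exact hf s a ‖a‖ (norm_nonneg _) fun i _ => c0_le_norm a i)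
  have hT : ∀ a, HasSum (fun i => a i • f i) (T a) := fun a => (hsum a).hasSum
  let Φ : E →L[ℝ] C₀(ℕ, ℝ) := LinearMap.mkContinuous
    { toFun := fun x =>
        { toFun := fun n => φ n x
          continuous_toFun := continuous_of_discreteTopology
          zero_at_infty' := by
            rw [Filter.cocompact_eq_cofinite, Nat.cofinite_eq_atTop]
            exact hφ0 x }
      map_add' := by
        intro x y; ext n; exact map_add (φ n) x y
      map_smul' := by
        intro c x; ext n; exact map_smul (φ n) c x } B (by
      intro x
      exact c0_norm_le _ (by positivity) fun n => hφB n x)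
  have hΦ : ∀ x n, Φ x n = φ n x := fun _ _ => rfl
  have hη0 : ∀ j, 0 ≤ η j := fun j => (abs_nonneg _).trans (hφf 0 j)
  have hr0 : 0 ≤ r := hη.nonneg hη0
  have hnorm : ‖(1 : C₀(ℕ, ℝ) →L[ℝ] C₀(ℕ, ℝ)) - Φ.comp T‖ ≤ r := by
    refine ContinuousLinearMap.opNorm_le_bound _ hr0 fun a => ?_
    refine c0_norm_le _ (by positivity) fun k => ?_
    have h1 : HasSum (fun j => a j * φ k (f j)) (φ k (T a)) := by
      have := (φ k).hasSum (hT a)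
      simpa using this
    have h2 : HasSum (fun j => a j * (if j = k then 1 else 0)) (a k) := by
      have := hasSum_ite_eq k (a k)
      convert this using 2 with j
      split_ifs with h
      · simp [h]
      · simp
    have h3 := h2.sub h1
    have h4 : ((1 : C₀(ℕ, ℝ) →L[ℝ] C₀(ℕ, ℝ)) - Φ.comp T) a k = a k - φ k (T a) := rfl
    rw [h4, ← h3.tsum_eq, mul_comm, ← Real.norm_eq_abs]
    have h5 := hη.mul_left ‖a‖
    refine tsum_of_norm_bounded h5 fun j => ?_
    rw [← mul_sub, norm_mul, Real.norm_eq_abs, Real.norm_eq_abs, abs_sub_comm]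
    exact mul_le_mul (c0_le_norm a j) (hφf k j) (abs_nonneg _) (norm_nonneg _)
  let u := Units.oneSub ((1 : C₀(ℕ, ℝ) →L[ℝ] C₀(ℕ, ℝ)) - Φ.comp T) (hnorm.trans_lt hr)
  have hu : (u : C₀(ℕ, ℝ) →L[ℝ] C₀(ℕ, ℝ)) = Φ.comp T := by
    exact ContinuousLinearMap.ext fun a => sub_sub_cancel a (Φ (T a))
  obtain ⟨h1, h2, h3⟩ := range_complemented T Φ (↑u⁻¹ : C₀(ℕ, ℝ) →L[ℝ] C₀(ℕ, ℝ)) (by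
    intro z
    have : (↑u⁻¹ * ↑u : C₀(ℕ, ℝ) →L[ℝ] C₀(ℕ, ℝ)) z = z := by rw [Units.inv_mul]; rfl
    rw [hu] at this
    exact this) c0_infinite
  refine ⟨_, ?_, h1, h2, h3⟩
  rintro _ ⟨a, rfl⟩
  exact hM.mem_of_tendsto (hT a) (Filter.Eventually.of_forall fun s =>
    M.sum_mem fun i _ => M.smul_mem _ (hfM i))

end SubprojAux2

theorem subprojective_continuousMap_of_scattered
    (K : Type*) [TopologicalSpace K] [CompactSpace K] [T2Space K]
    (X : Type*) [NormedAddCommGroup X] [NormedSpace ℝ X] [CompleteSpace X]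
    (hK : IsScattered K) (hX : Subprojective X) :
    Subprojective C(K, X) := by
  classical
  intro M hM hMinf
  have hMfg : ¬ M.FG := fun h => hMinf (Module.Finite.iff_fg.2 h)
  by_cases hpt : ∃ t, ¬ SmallOn M ({t} : Set K)
  · obtain ⟨t, ht⟩ := hpt
    obtain ⟨N, hNM, hN, c, hc, h⟩ := not_smallOn ht
    refine case_one hX (ContinuousMap.evalCLM ℝ t) M N hM hNM hN c hc fun f hf => ?_
    by_cases hf0 : f = 0
    · simp [hf0]
    · obtain ⟨s, hs, h'⟩ := h f hf hf0
      rw [Set.mem_singleton_iff] at hs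
      subst hs
      exact h'.le
  push Not at hpt
  -- the bad points
  let B : Set K := {t | ∀ T ∈ nhds t, ¬ SmallOn M T}
  have hBc : IsClosed B := by
    rw [← isOpen_compl_iff, isOpen_iff_mem_nhds]
    intro x hx
    have hx : ¬ ∀ T ∈ nhds x, ¬ SmallOn M T := hx
    push Not at hx
    obtain ⟨T, hT, hTs⟩ := hx
    filter_upwards [eventually_mem_nhds_iff.2 hT] with y hy hyB
    exact hyB T hy hTs
  have hBn : B.Nonempty := by
    by_contra hB
    rw [Set.not_nonempty_iff_eq_empty] at hB
    refine not_smallOn_univ hMfg (smallOn_of_compact isCompact_univ fun s _ => ?_)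
    by_contra! h
    have : s ∈ B := h
    rw [hB] at this
    exact this
  obtain ⟨t, htB, U, hU, hUB⟩ := hK B hBn hBc
  have htU : t ∈ U := by
    have : t ∈ U ∩ B := by rw [hUB]; rfl
    exact this.1
  obtain ⟨V, hV, hVc, hVU⟩ := exists_mem_nhds_isClosed_subset (hU.mem_nhds htU)
  obtain ⟨N, hNM, hN, c, hc, hNc⟩ := not_smallOn (htB V hV)
  have hgood : ∀ S : Set K, IsCompact S → S ⊆ V → t ∉ S → SmallOn M S := by
    intro S hS hSV htS
    refine smallOn_of_compact hS fun s hs => ?_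
    by_contra! h
    have : s ∈ U ∩ B := ⟨hVU (hSV hs), h⟩
    rw [hUB] at this
    exact htS (this ▸ hs)
  obtain ⟨F, hF1, hF2⟩ := exists_seq_of_forall_finset_exists
    (fun p : C(K, X) × ℝ => p.1 ∈ N ∧ ‖p.1‖ = 1 ∧ 0 < p.2 ∧ p.2 ≤ c / 8 ∧ ‖p.1 t‖ < p.2)
    (fun p q => q.2 ≤ p.2 / 2 ∧ ∀ v ∈ V, p.2 ≤ ‖p.1 v‖ → ‖q.1 v‖ ≤ q.2) (by
      intro s hs
      obtain ⟨η, hη0, hη1, hη2⟩ : ∃ η > 0, η ≤ c / 8 ∧ ∀ p ∈ s, η ≤ p.2 / 2 := by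
        have : ∀ᶠ η in nhdsWithin (0:ℝ) (Set.Ioi 0), η ≤ c / 8 ∧ ∀ p ∈ s, η ≤ p.2 / 2 := by
          refine Filter.Eventually.and ?_ ?_
          · exact (eventually_le_nhds (by positivity)).filter_mono nhdsWithin_le_nhds
          · rw [Filter.eventually_all_finset]
            intro p hp
            have := (hs p hp).2.2.1
            exact (eventually_le_nhds (by positivity)).filter_mono nhdsWithin_le_nhds
        obtain ⟨η, h, h'⟩ := (this.and self_mem_nhdsWithin).exists
        exact ⟨η, h', h⟩
      let S : Set K := ⋃ p ∈ s, V ∩ {v | p.2 ≤ ‖p.1 v‖}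
      have hSc : IsCompact S := by
        refine s.isCompact_biUnion fun p _ => IsClosed.isCompact ?_
        exact hVc.inter (isClosed_le (by fun_prop) (by fun_prop))
      have hSV : S ⊆ V := Set.iUnion₂_subset fun p _ => Set.inter_subset_left
      have htS : t ∉ S := by
        intro h
        obtain ⟨p, hp, h⟩ := Set.mem_iUnion₂.1 h
        exact absurd h.2 (not_le.2 (hs p hp).2.2.2.2)
      obtain ⟨N', hN'N, hN', hsm⟩ := ((hgood S hSc hSV htS).union (hpt t)) N hNM hN (η / 2)
        (by positivity)
      obtain ⟨f, hf, hf0⟩ := ne_zero_of_not_fg hN'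
      have hfn : 0 < ‖f‖ := norm_pos_iff.2 hf0
      have hg1 : ‖‖f‖⁻¹ • f‖ = 1 := by rw [norm_smul, norm_inv, norm_norm]; field_simp
      have hsm' : ∀ v ∈ S ∪ {t}, ‖(‖f‖⁻¹ • f) v‖ ≤ η / 2 := by
        intro v hv
        have := hsm _ (N'.smul_mem ‖f‖⁻¹ hf) v hv
        rwa [hg1, mul_one] at this
      refine ⟨⟨‖f‖⁻¹ • f, η⟩, ⟨N.smul_mem _ (hN'N hf), hg1, hη0, hη1, ?_⟩, ?_⟩
      · have := hsm' t (Or.inr rfl)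
        change ‖(‖f‖⁻¹ • f) t‖ < η
        linarith
      · intro p hp
        refine ⟨hη2 p hp, fun v hv hpv => ?_⟩
        have := hsm' v (Or.inl (Set.mem_iUnion₂.2 ⟨p, hp, hv, hpv⟩))
        change ‖(‖f‖⁻¹ • f) v‖ ≤ η
        linarith)
  have hex : ∀ n, ∃ v ∈ V, c < ‖(F n).1 v‖ := by
    intro n
    obtain ⟨v, hv, h⟩ := hNc (F n).1 (hF1 n).1 (by
      intro h; have := (hF1 n).2.1; rw [h] at this; simp at this)
    rw [(hF1 n).2.1, mul_one] at h
    exact ⟨v, hv, h⟩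
  choose τ₀ hτ₀V hτ₀c using hex
  obtain ⟨s, ψ, hψ, hlim⟩ := exists_subseq_tendsto hK τ₀
  obtain ⟨g, hg⟩ : ∃ g : ℕ → C(K, X), ∀ n, g n = (F (ψ n)).1 := ⟨_, fun _ => rfl⟩
  obtain ⟨e, he⟩ : ∃ e : ℕ → ℝ, ∀ n, e n = (F (ψ n)).2 := ⟨_, fun _ => rfl⟩
  obtain ⟨τ, hτ⟩ : ∃ τ : ℕ → K, ∀ n, τ n = τ₀ (ψ n) := ⟨_, fun _ => rfl⟩
  have hgN : ∀ n, g n ∈ N := fun n => hg n ▸ (hF1 (ψ n)).1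
  have hg1 : ∀ n, ‖g n‖ = 1 := fun n => hg n ▸ (hF1 (ψ n)).2.1
  have he0 : ∀ n, 0 < e n := fun n => he n ▸ (hF1 (ψ n)).2.2.1
  have hec : ∀ n, e n ≤ c / 8 := fun n => he n ▸ (hF1 (ψ n)).2.2.2.1
  have hτV : ∀ n, τ n ∈ V := fun n => hτ n ▸ hτ₀V (ψ n)
  have hτc : ∀ n, c < ‖g n (τ n)‖ := fun n => by rw [hτ, hg]; exact hτ₀c (ψ n)
  have hlim : Filter.Tendsto τ Filter.atTop (nhds s) := hlim.congr fun n => (hτ n).symm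
  have hr : ∀ m n, m < n → ∀ v ∈ V, e m ≤ ‖g m v‖ → ‖g n v‖ ≤ e n := by
    intro m n hmn
    rw [he, he, hg, hg]
    exact (hF2 _ _ (hψ hmn)).2
  have heh : ∀ n, e n ≤ c / 8 * (1/2) ^ n := by
    intro n
    induction n with
    | zero => simpa using hec 0
    | succ n ih =>
      have : e (n+1) ≤ e n / 2 := by
        rw [he, he]
        exact (hF2 _ _ (hψ (Nat.lt_succ_self n))).1
      rw [pow_succ]; linarith
  clear hF1 hF2 hτ₀V hτ₀c hg he hτ
  have hoff : ∀ j k, j ≠ k → ‖g j (τ k)‖ ≤ e j := by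
    intro j k hjk
    rcases lt_or_gt_of_ne hjk with h | h
    · by_contra! h'
      have := hr j k h (τ k) (hτV k) h'.le
      linarith [hτc k, hec k]
    · exact hr k j h (τ k) (hτV k) (by linarith [hτc k, hec k])
  have hgs : ∀ j, ‖g j s‖ ≤ e j := by
    intro j
    have h1 : Filter.Tendsto (fun k => ‖g j (τ k)‖) Filter.atTop (nhds ‖g j s‖) :=
      (((g j).continuous.tendsto s).comp hlim).norm
    refine le_of_tendsto h1 ?_
    filter_upwards [Filter.eventually_gt_atTop j] with k hk
    exact hoff j k hk.ne
  have hgeom : HasSum (fun n : ℕ => ((1:ℝ)/2)^n) 2 := hasSum_geometric_two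
  choose ξ hξ1 hξ using fun k => exists_dual_vector'' ℝ (g k (τ k))
  let φ : ℕ → C(K, X) →L[ℝ] ℝ := fun k =>
    ‖g k (τ k)‖⁻¹ • (ξ k).comp (ContinuousMap.evalCLM ℝ (τ k) - ContinuousMap.evalCLM ℝ s)
  have hφ : ∀ k x, φ k x = ‖g k (τ k)‖⁻¹ * ξ k (x (τ k) - x s) := fun _ _ => rfl
  have hpos : ∀ k, 0 < ‖g k (τ k)‖ := fun k => hc.trans (hτc k)
  have hξb : ∀ k (y : X), |‖g k (τ k)‖⁻¹ * ξ k y| ≤ c⁻¹ * ‖y‖ := by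
    intro k y
    rw [abs_mul, abs_of_pos (inv_pos.2 (hpos k))]
    have h1 : |ξ k y| ≤ ‖y‖ := by
      have := (ξ k).le_of_opNorm_le (hξ1 k) y
      simpa using this
    exact mul_le_mul (inv_anti₀ hc (hτc k).le) h1 (abs_nonneg _) (by positivity)
  refine case_two M hM g (fun n => hNM (hgN n)) (2 * c⁻¹ + 1) (by positivity) ?_ φ (c⁻¹ * 2)
    (by positivity) ?_ ?_ (fun j => 1/4 * (1/2)^j) (1/4 * 2) (hgeom.mul_left _) (by norm_num) ?_
  · intro S a b hb hab
    set y := ∑ i ∈ S, a i • g i with hy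
    have hyN : y ∈ N := N.sum_mem fun i _ => N.smul_mem _ (hgN i)
    by_cases hy0 : y = 0
    · rw [hy0, norm_zero]; positivity
    obtain ⟨v, hv, hcv⟩ := hNc y hyN hy0
    obtain ⟨j₀, hj₀⟩ : ∃ j₀, ∀ i, i ≠ j₀ → ‖g i v‖ ≤ e i := by
      by_cases h : ∃ j, e j < ‖g j v‖
      · obtain ⟨j, hj⟩ := h
        refine ⟨j, fun i hi => ?_⟩
        rcases lt_or_gt_of_ne hi with h | h
        · by_contra! h'
          exact absurd (hr i j h v hv h'.le) (not_le.2 hj)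
        · exact hr j i h v hv hj.le
      · push Not at h
        exact ⟨0, fun i _ => h i⟩
    have hbd : ∀ i, ‖g i v‖ ≤ (if i = j₀ then 1 else 0) + c / 8 * (1/2)^i := by
      intro i
      split_ifs with h
      · have := (g i).norm_coe_le_norm v
        rw [hg1] at this
        have : (0:ℝ) < c / 8 * (1/2)^i := by positivity
        linarith
      · rw [zero_add]; exact (hj₀ i h).trans (heh i)
    have hs2 : ∑ i ∈ S, ‖g i v‖ ≤ 1 + c / 8 * 2 :=
      (Finset.sum_le_sum fun i _ => hbd i).trans
        (sum_le_hasSum S (fun i _ => by split_ifs <;> positivity)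
          ((hasSum_ite_eq j₀ (1:ℝ)).add (hgeom.mul_left (c / 8))))
    have hyv : ‖y v‖ ≤ b * (1 + c / 8 * 2) := by
      rw [hy, ContinuousMap.sum_apply]
      refine (norm_sum_le _ _).trans ?_
      refine le_trans ?_ (mul_le_mul_of_nonneg_left hs2 hb)
      rw [Finset.mul_sum]
      refine Finset.sum_le_sum fun i hi => ?_
      rw [ContinuousMap.smul_apply, norm_smul, Real.norm_eq_abs]
      exact mul_le_mul_of_nonneg_right (hab i hi) (norm_nonneg _)
    have : c * ‖y‖ ≤ c * ((2 * c⁻¹ + 1) * b) := by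
      have : c * ((2 * c⁻¹ + 1) * b) = b * (2 + c) := by field_simp
      rw [this]
      refine (hcv.le.trans hyv).trans (mul_le_mul_of_nonneg_left ?_ hb)
      linarith
    exact le_of_mul_le_mul_left this hc
  · intro n x
    rw [hφ]
    refine (hξb n _).trans ?_
    rw [mul_assoc]
    refine mul_le_mul_of_nonneg_left ?_ (by positivity)
    refine (norm_sub_le _ _).trans ?_
    linarith [x.norm_coe_le_norm (τ n), x.norm_coe_le_norm s]
  · intro x
    have h1 : Filter.Tendsto (fun k => c⁻¹ * ‖x (τ k) - x s‖) Filter.atTop (nhds 0) := by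
      have := ((((x.continuous.tendsto s).comp hlim).sub_const (x s)).norm).const_mul c⁻¹
      simpa using this
    refine squeeze_zero_norm (fun k => ?_) h1
    rw [hφ]
    exact hξb k _
  · intro k j
    have hb : c⁻¹ * (2 * e j) ≤ 1/4 * (1/2)^j := by
      have := heh j
      rw [inv_mul_le_iff₀ hc]; linarith
    refine le_trans ?_ hb
    rw [hφ]
    split_ifs with h
    · subst h
      have : ‖g j (τ j)‖⁻¹ * ξ j (g j (τ j) - g j s) - 1
          = - (‖g j (τ j)‖⁻¹ * ξ j (g j s)) := by
        have := (hpos j).ne'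
        rw [map_sub, hξ, mul_sub]
        simp [this]
      rw [this, abs_neg]
      refine (hξb j _).trans (mul_le_mul_of_nonneg_left ?_ (by positivity))
      linarith [hgs j, he0 j]
    · rw [sub_zero]
      refine (hξb k _).trans (mul_le_mul_of_nonneg_left ?_ (by positivity))
      refine (norm_sub_le _ _).trans ?_
      linarith [hgs j, hoff j k h]
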